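/- Let S be a finitely generated commutative semigroup all of whose endomorphisms are power functions, i.e., for every endomorphism f of S there exists a positive integer n such that f(x) = x^n for all x ∈ S. Then either S is finite and contains exactly one idempotent, or S contains no idempotents. -/

import Mathlib

/-- `spow x n` is the `(n+1)`-st power `x^(n+1)` of `x` in a semigroup. -/
def spow {S : Type*} [Semigroup S] (x : S) : ℕ → S
  | 0 => x
  | n + 1 => spow x n * x

theorem WithOne.coe_spow {S : Type*} [Semigroup S] (x : S) (n : ℕ) :
    ((spow x n : S) : WithOne S) = (x : WithOne S) ^ (n + 1) := by
  induction n with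
  | zero => simp [spow]
  | succ n ih => rw [spow, WithOne.coe_mul, ih, ← pow_succ]

theorem spow_eq_self_of_mul_self {S : Type*} [Semigroup S] {e : S} (he : e * e = e) (n : ℕ) :
    spow e n = e := by
  induction n with
  | zero => rfl
  | succ n ih => rw [spow, ih, he]

theorem Submonoid.finite_powers_of_pow_eq_pow {M : Type*} [Monoid M] {x : M} {m n : ℕ}
    (hmn : m < n) (h : x ^ n = x ^ m) : (Submonoid.powers x : Set M).Finite := by
  refine ((Set.finite_Iio n).image (x ^ ·)).subset ?_
  rintro _ ⟨k, rfl⟩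
  induction k using Nat.strong_induction_on with
  | _ k ih =>
    by_cases hk : k < n
    · exact ⟨k, hk, rfl⟩
    · have hx : x ^ k = x ^ (k - n + m) := by
        rw [pow_add, ← h, ← pow_add, Nat.sub_add_cancel (not_lt.mp hk)]
      simpa only [hx] using ih (k - n + m) (by omega)

theorem Submonoid.finite_closure_of_finite_powers {M : Type*} [CommMonoid M] {s : Set M}
    (hs : s.Finite) (h : ∀ x ∈ s, (Submonoid.powers x : Set M).Finite) :
    (Submonoid.closure s : Set M).Finite := by
  induction s, hs using Set.Finite.induction_on with
  | empty => simp
  | @insert a s _ _ ih =>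
    rw [Set.insert_eq, Submonoid.closure_union, ← Submonoid.powers_eq_closure, Submonoid.coe_sup]
    exact (h a (Set.mem_insert a s)).mul (ih fun x hx => h x (Set.mem_insert_of_mem a hx))

/-- A finitely generated commutative Lesokhin semigroup (every endomorphism is
a power function `x ↦ xⁿ`) is either finite with exactly one idempotent, or
has no idempotents at all. -/
theorem fg_lesokhin_semigroup_dichotomy {S : Type*} [CommSemigroup S]
    (hfg : ∃ F : Finset S, Subsemigroup.closure (F : Set S) = ⊤)
    (hpow : ∀ f : S → S, (∀ x y : S, f (x * y) = f x * f y) →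
      ∃ n : ℕ, ∀ x : S, f x = spow x n) :
    (Finite S ∧ ∃! e : S, e * e = e) ∨ (∀ e : S, e * e ≠ e) := by
  by_cases hidem : ∃ e : S, e * e = e
  swap
  · exact Or.inr (not_exists.mp hidem)
  obtain ⟨e, he⟩ := hidem
  obtain ⟨n, hn⟩ := hpow (fun _ => e) fun _ _ => he.symm
  refine Or.inl ⟨?_, e, he, fun f hf => (spow_eq_self_of_mul_self hf n).symm.trans (hn f).symm⟩
  obtain ⟨F, hF⟩ := hfg
  have hxn (x : S) : (x : WithOne S) ^ (n + 1) = e := by rw [← WithOne.coe_spow, ← hn x]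
  have hfin : (Submonoid.closure ((↑) '' (F : Set S) : Set (WithOne S)) : Set (WithOne S)).Finite := by
    refine Submonoid.finite_closure_of_finite_powers (F.finite_toSet.image _) ?_
    rintro _ ⟨x, _, rfl⟩
    refine Submonoid.finite_powers_of_pow_eq_pow (m := n + 1) (n := (n + 1) + (n + 1)) (by omega) ?_
    rw [pow_add, hxn, ← WithOne.coe_mul, he]
  have hmem (x : S) : (x : WithOne S) ∈
      Submonoid.closure ((↑) '' (F : Set S) : Set (WithOne S)) := by
    have hx : x ∈ Subsemigroup.closure (F : Set S) := hF ▸ Subsemigroup.mem_top x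
    induction hx using Subsemigroup.closure_induction with
    | mem x hx => exact Submonoid.subset_closure ⟨x, hx, rfl⟩
    | mul x y _ _ hx hy => rw [WithOne.coe_mul]; exact mul_mem hx hy
  have := hfin.to_subtype
  exact Finite.of_injective
    (fun x : S => (⟨x, hmem x⟩ : (Submonoid.closure ((↑) '' (F : Set S) : Set (WithOne S)) :
      Set (WithOne S)))) fun x y hxy => WithOne.coe_injective (congrArg Subtype.val hxy)
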